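/- Let σ_S, σ_T ∈ S_n²(k) be the greedy involutions σ_{J_S}, σ_{J_T} of two k-element subsets J_S, J_T of {1,...,n} (each satisfying that its s-th smallest element is ≥ 2s for all s). Let (a_1,b_1), ..., (a_t,b_t) be the 1-segments of R_{σ_S,σ_T}, ordered so that a_1 < a_2 < ... < a_t. Suppose there exists s with 1 ≤ s < t such that either a_{s+1} = b_s, or both a_{s+1} < b_s and (R_{σ_S,σ_T})_{a_s, b_{s+1}} = 1. Then the set {τ ∈ S_n² : (R_τ)_{i,j} ≤ (R_{σ_S,σ_T})_{i,j} for all i,j} has at least two distinct maximal elements with respect to ⪯. -/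

import Mathlib

namespace LinkPat

variable {n : ℕ}

/-- `σ` is an involution (σ² = id). -/
def IsInvol (σ : Equiv.Perm (Fin n)) : Prop := ∀ p, σ (σ p) = p

/-- `(i,j)` is an arc of `σ`: `i < j` and `σ i = j`. -/
def IsArc (σ : Equiv.Perm (Fin n)) (i j : Fin n) : Prop := i < j ∧ σ i = j

/-- The finite set of arcs of `σ`. -/
def arcs (σ : Equiv.Perm (Fin n)) : Finset (Fin n × Fin n) :=
  Finset.univ.filter fun a => a.1 < a.2 ∧ σ a.1 = a.2

/-- The number of arcs of `σ`. -/
def numArcs (σ : Equiv.Perm (Fin n)) : ℕ := (arcs σ).card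

/-- `c(σ)`: the number of crossings, i.e. pairs of arcs `(i,j)`, `(i',j')` with
`i < i' < j < j'`. -/
def crossNum (σ : Equiv.Perm (Fin n)) : ℕ :=
  ((arcs σ ×ˢ arcs σ).filter fun x => x.1.1 < x.2.1 ∧ x.2.1 < x.1.2 ∧ x.1.2 < x.2.2).card

/-- `f(σ)`: the sum over fixed points `p` of the number of arcs over `p`. -/
def fixNum (σ : Equiv.Perm (Fin n)) : ℕ :=
  (((Finset.univ.filter fun p => σ p = p) ×ˢ arcs σ).filter
    fun x => x.2.1 < x.1 ∧ x.1 < x.2.2).card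

/-- The rank matrix `R_σ`: entry `(i,j)` is the number of arcs inside `[i,j]`. -/
def Rmat (σ : Equiv.Perm (Fin n)) (i j : Fin n) : ℕ :=
  ((arcs σ).filter fun a => i ≤ a.1 ∧ a.2 ≤ j).card

/-- The partial order `σ' ⪯ σ` given by pointwise comparison of rank matrices. -/
def rle (σ' σ : Equiv.Perm (Fin n)) : Prop := ∀ i j, Rmat σ' i j ≤ Rmat σ i j

/-- The strict order `σ' ≺ σ`. -/
def rlt (σ' σ : Equiv.Perm (Fin n)) : Prop := rle σ' σ ∧ σ' ≠ σ

end LinkPat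

namespace LinkPat

/-- The condition `j_s ≥ 2s` for every element of `J` (`j ∈ J` being the `s`-th
smallest element, `s = #{x ∈ J : x ≤ j}`); points are `1`-based, i.e. the point
corresponding to `j : Fin n` is `(j : ℕ) + 1`. -/
def JCond {n : ℕ} (J : Finset (Fin n)) : Prop :=
  ∀ j ∈ J, 2 * (J.filter fun x => x ≤ j).card ≤ (j : ℕ) + 1

/-- `σ` is the greedy involution `σ_J` associated to `J`: `σ` is an involution, the
larger endpoints of its arcs are exactly the elements of `J`, and for `j ∈ J` the
partner `σ j` is the largest `d < j` which is neither in `J` nor a partner `σ j'`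
of some earlier `j' ∈ J`, `j' < j`. -/
def GreedyInv {n : ℕ} (σ : Equiv.Perm (Fin n)) (J : Finset (Fin n)) : Prop :=
  IsInvol σ ∧ (∀ p : Fin n, σ p < p ↔ p ∈ J) ∧
  ∀ j ∈ J, ∀ d : Fin n, σ j < d → d < j → d ∈ J ∨ ∃ j' ∈ J, j' < j ∧ σ j' = d

end LinkPat

namespace LinkPat

/-- The entry `(i,j)` of the intersection matrix `R_{σ,τ}`. -/
def Rmin {n : ℕ} (σ τ : Equiv.Perm (Fin n)) (i j : Fin n) : ℕ :=
  min (Rmat σ i j) (Rmat τ i j)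

/-- `(a,b)` is a 1-segment of `R_{σ,τ}`: `a < b`, `(R_{σ,τ})_{a,b} = 1`, and every
other entry `(p,q)` with `a ≤ p < q ≤ b` vanishes. -/
def OneSeg {n : ℕ} (σ τ : Equiv.Perm (Fin n)) (a b : Fin n) : Prop :=
  a < b ∧ Rmin σ τ a b = 1 ∧
    ∀ p q : Fin n, a ≤ p → p < q → q ≤ b → (p, q) ≠ (a, b) → Rmin σ τ p q = 0

end LinkPat

namespace LinkPat

variable {n : ℕ}

theorem mem_arcs {σ : Equiv.Perm (Fin n)} {x : Fin n × Fin n} :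
    x ∈ arcs σ ↔ x.1 < x.2 ∧ σ x.1 = x.2 := by
  simp [arcs]

theorem Rmat_mono (σ : Equiv.Perm (Fin n)) {i j p q : Fin n} (hi : i ≤ p) (hj : q ≤ j) :
    Rmat σ p q ≤ Rmat σ i j := by
  refine Finset.card_le_card fun x hx => ?_
  rw [Finset.mem_filter] at hx ⊢
  exact ⟨hx.1, hi.trans hx.2.1, hx.2.2.trans hj⟩

theorem Rmin_mono (σ τ : Equiv.Perm (Fin n)) {i j p q : Fin n} (hi : i ≤ p) (hj : q ≤ j) :
    Rmin σ τ p q ≤ Rmin σ τ i j :=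
  min_le_min (Rmat_mono σ hi hj) (Rmat_mono τ hi hj)

/-- An involution is determined by its set of arcs. -/
theorem eq_of_arcs_eq {σ τ : Equiv.Perm (Fin n)} (hσ : IsInvol σ) (hτ : IsInvol τ)
    (h : arcs σ = arcs τ) : σ = τ := by
  have key : ∀ p q : Fin n, p < q → (σ p = q ↔ τ p = q) := fun p q hpq => by
    have := congrArg (fun s => (p, q) ∈ s) h
    simpa [mem_arcs, hpq] using this
  ext p
  congr 1
  rcases lt_trichotomy (σ p) p with h1 | h1 | h1
  · have := (key _ _ h1).1 (hσ p)
    rw [← this, hτ, this]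
  · rcases lt_trichotomy (τ p) p with h2 | h2 | h2
    · have := (key _ _ h2).2 (hτ p)
      rw [← this, hσ, this]
    · rw [h1, h2]
    · exact (key _ _ h2).2 rfl
  · exact ((key _ _ h1).1 rfl).symm

/-- The rank matrix determines the set of arcs. -/
theorem arcs_eq_of_Rmat_eq {σ τ : Equiv.Perm (Fin n)}
    (h : ∀ i j, Rmat σ i j = Rmat τ i j) : arcs σ = arcs τ := by
  have key : ∀ (L : ℕ) (i j : Fin n), (j : ℕ) - i = L →
      ((i, j) ∈ arcs σ ↔ (i, j) ∈ arcs τ) := by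
    intro L
    induction L using Nat.strong_induction_on with
    | _ L ih =>
      intro i j hL
      by_cases hij : i < j
      swap
      · simp [mem_arcs, hij]
      have herase : ((arcs σ).filter fun x => i ≤ x.1 ∧ x.2 ≤ j).erase (i, j) =
          ((arcs τ).filter fun x => i ≤ x.1 ∧ x.2 ≤ j).erase (i, j) := by
        ext ⟨p, q⟩
        simp only [Finset.mem_erase, Finset.mem_filter]
        refine and_congr_right fun hne => and_congr_left fun hpq => ?_
        by_cases hlt : p < q
        swap
        · simp [mem_arcs, hlt]
        refine ih _ ?_ p q rfl
        rw [ne_eq, Prod.mk.injEq, Fin.ext_iff, Fin.ext_iff] at hne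
        simp only [Fin.le_def, Fin.lt_def] at hpq hlt hij
        omega
      have hc := h i j
      unfold Rmat at hc
      have hcσ := Finset.card_erase_eq_ite (s := (arcs σ).filter fun x => i ≤ x.1 ∧ x.2 ≤ j)
        (a := (i, j))
      have hcτ := Finset.card_erase_eq_ite (s := (arcs τ).filter fun x => i ≤ x.1 ∧ x.2 ≤ j)
        (a := (i, j))
      have hpos : ∀ ρ : Equiv.Perm (Fin n), (i, j) ∈ arcs ρ →
          0 < ((arcs ρ).filter fun x => i ≤ x.1 ∧ x.2 ≤ j).card := fun ρ hρ =>
        Finset.card_pos.2 ⟨(i, j), by simp [hρ]⟩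
      have hpσ := hpos σ
      have hpτ := hpos τ
      rw [herase] at hcσ
      simp only [Finset.mem_filter, le_refl, and_self, and_true] at hcσ hcτ
      by_cases h1 : (i, j) ∈ arcs σ <;> by_cases h2 : (i, j) ∈ arcs τ <;>
        simp only [h1, h2, if_true, if_false, forall_true_left, iff_self, iff_false, iff_true,
          not_true_eq_false] at hcσ hcτ hpσ hpτ ⊢ <;> omega
  ext ⟨i, j⟩
  exact key _ i j rfl

theorem rle_antisymm {σ τ : Equiv.Perm (Fin n)} (hσ : IsInvol σ) (hτ : IsInvol τ)
    (h : rle σ τ) (h' : rle τ σ) : σ = τ :=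
  eq_of_arcs_eq hσ hτ (arcs_eq_of_Rmat_eq fun i j => (h i j).antisymm (h' i j))

theorem arcs_swap {a b : Fin n} (hab : a < b) : arcs (Equiv.swap a b) = {(a, b)} := by
  ext ⟨p, q⟩
  simp only [mem_arcs, Finset.mem_singleton, Prod.mk.injEq]
  constructor
  · rintro ⟨hpq, rfl⟩
    rcases eq_or_ne p a with rfl | hpa
    · simp
    rcases eq_or_ne p b with rfl | hpb
    · rw [Equiv.swap_apply_right] at hpq
      exact absurd hpq hab.asymm
    · rw [Equiv.swap_apply_of_ne_of_ne hpa hpb] at hpq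
      exact absurd hpq (lt_irrefl p)
  · rintro ⟨rfl, rfl⟩
    exact ⟨hab, Equiv.swap_apply_left p q⟩

/-- Below a monotone matrix that is positive at `(a, b)` there is a maximal involution
with an arc inside `[a, b]`. -/
theorem exists_maximal_of_pos {M : Fin n → Fin n → ℕ}
    (hM : ∀ i j p q, i ≤ p → q ≤ j → M p q ≤ M i j) {a b : Fin n} (hab : a < b)
    (hpos : 0 < M a b) :
    ∃ τ : Equiv.Perm (Fin n), 0 < Rmat τ a b ∧ IsInvol τ ∧ (∀ i j, Rmat τ i j ≤ M i j) ∧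
      ∀ τ' : Equiv.Perm (Fin n), IsInvol τ' → (∀ i j, Rmat τ' i j ≤ M i j) →
        rle τ τ' → τ' = τ := by
  classical
  let A : Finset (Equiv.Perm (Fin n)) := Finset.univ.filter fun τ =>
    0 < Rmat τ a b ∧ IsInvol τ ∧ ∀ i j, Rmat τ i j ≤ M i j
  have hmem : Equiv.swap a b ∈ A := by
    simp only [A, Finset.mem_filter, Finset.mem_univ, true_and]
    refine ⟨?_, fun p => ?_, fun i j => ?_⟩
    · exact Finset.card_pos.2 ⟨(a, b), by simp [arcs_swap hab]⟩
    · rw [← Equiv.Perm.mul_apply, Equiv.swap_mul_self, Equiv.Perm.one_apply]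
    · rw [Rmat, arcs_swap hab, Finset.filter_singleton]
      split_ifs with hij
      · exact (Nat.succ_le_of_lt hpos).trans (hM i j a b hij.1 hij.2)
      · simp
  obtain ⟨τ, hτA, hmax⟩ := A.exists_max_image (fun τ => ∑ i, ∑ j, Rmat τ i j) ⟨_, hmem⟩
  have hτ := (Finset.mem_filter.1 hτA).2
  refine ⟨τ, hτ.1, hτ.2.1, hτ.2.2, fun τ' hinv hle hr => ?_⟩
  have hsum := hmax τ' (Finset.mem_filter.2
    ⟨Finset.mem_univ _, hτ.1.trans_le (hr a b), hinv, hle⟩)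
  refine rle_antisymm hinv hτ.2.1 (fun i j => ?_) hr
  by_contra! hlt
  refine hsum.not_gt (Finset.sum_lt_sum (fun p _ => Finset.sum_le_sum fun q _ => hr p q)
    ⟨i, Finset.mem_univ _, Finset.sum_lt_sum (fun q _ => hr i q) ⟨j, Finset.mem_univ _, hlt⟩⟩)

/-- An involution below `R_{σ,τ}` with an arc inside a 1-segment has that segment as an arc. -/
theorem OneSeg.mem_arcs_of_pos {σ τ ρ : Equiv.Perm (Fin n)} {a b : Fin n}
    (hseg : OneSeg σ τ a b) (hle : ∀ i j, Rmat ρ i j ≤ Rmin σ τ i j) (hpos : 0 < Rmat ρ a b) :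
    (a, b) ∈ arcs ρ := by
  obtain ⟨⟨p, q⟩, hpq⟩ := Finset.card_pos.1 hpos
  obtain ⟨harc, hap, hqb⟩ := Finset.mem_filter.1 hpq
  by_cases hne : (p, q) = (a, b)
  · exact hne ▸ harc
  have hzero := hseg.2.2 p q hap (mem_arcs.1 harc).1 hqb hne
  have hone : 0 < Rmat ρ p q := Finset.card_pos.2 ⟨(p, q), by simp [harc]⟩
  have := hle p q
  omega

end LinkPat

/-- if two consecutive 1-segments `(a_s,b_s)`, `(a_{s+1},b_{s+1})` of
`R_{σ_S,σ_T}` satisfy `a_{s+1} = b_s`, or `a_{s+1} < b_s` together with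
`(R_{σ_S,σ_T})_{a_s,b_{s+1}} = 1`, then the set of involutions `τ` with
`R_τ ⪯ R_{σ_S,σ_T}` has at least two distinct maximal elements. -/
theorem two_maximal_elements (n k : ℕ)
    (JS JT : Finset (Fin n)) (hcardS : JS.card = k) (hcardT : JT.card = k)
    (hJS : LinkPat.JCond JS) (hJT : LinkPat.JCond JT)
    (σS σT : Equiv.Perm (Fin n))
    (hgS : LinkPat.GreedyInv σS JS) (hgT : LinkPat.GreedyInv σT JT)
    (a b a' b' : Fin n)
    (hseg : LinkPat.OneSeg σS σT a b) (hseg' : LinkPat.OneSeg σS σT a' b')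
    (haa' : a < a')
    (hconsec : ∀ a'' b'' : Fin n, LinkPat.OneSeg σS σT a'' b'' → ¬(a < a'' ∧ a'' < a'))
    (hcond : a' = b ∨ (a' < b ∧ LinkPat.Rmin σS σT a b' = 1)) :
    ∃ τ₁ τ₂ : Equiv.Perm (Fin n), τ₁ ≠ τ₂ ∧
      (LinkPat.IsInvol τ₁ ∧ (∀ i j : Fin n, LinkPat.Rmat τ₁ i j ≤ LinkPat.Rmin σS σT i j) ∧
        ∀ τ : Equiv.Perm (Fin n), LinkPat.IsInvol τ →
          (∀ i j : Fin n, LinkPat.Rmat τ i j ≤ LinkPat.Rmin σS σT i j) →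
          LinkPat.rle τ₁ τ → τ = τ₁) ∧
      (LinkPat.IsInvol τ₂ ∧ (∀ i j : Fin n, LinkPat.Rmat τ₂ i j ≤ LinkPat.Rmin σS σT i j) ∧
        ∀ τ : Equiv.Perm (Fin n), LinkPat.IsInvol τ →
          (∀ i j : Fin n, LinkPat.Rmat τ i j ≤ LinkPat.Rmin σS σT i j) →
          LinkPat.rle τ₂ τ → τ = τ₂) := by
  obtain ⟨τ₁, hp₁, hinv₁, hle₁, hmax₁⟩ := LinkPat.exists_maximal_of_pos
    (fun _ _ _ _ hi hj => LinkPat.Rmin_mono σS σT hi hj) hseg.1 (by rw [hseg.2.1]; exact one_pos)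
  obtain ⟨τ₂, hp₂, hinv₂, hle₂, hmax₂⟩ := LinkPat.exists_maximal_of_pos
    (fun _ _ _ _ hi hj => LinkPat.Rmin_mono σS σT hi hj) hseg'.1 (by rw [hseg'.2.1]; exact one_pos)
  refine ⟨τ₁, τ₂, ?_, ⟨hinv₁, hle₁, hmax₁⟩, ⟨hinv₂, hle₂, hmax₂⟩⟩
  rintro rfl
  have harc := hseg.mem_arcs_of_pos hle₁ hp₁
  have harc' := hseg'.mem_arcs_of_pos hle₁ hp₂
  rcases hcond with rfl | ⟨-, hone⟩
  · have h1 : τ₁ a = a' := (LinkPat.mem_arcs.1 harc).2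
    have h2 : τ₁ a' = b' := (LinkPat.mem_arcs.1 harc').2
    have h3 : a = b' := by rw [← h2, ← h1, hinv₁]
    exact absurd hseg'.1 (h3 ▸ haa'.asymm)
  · have hne : (a, b) ≠ (a', b') := fun h => haa'.ne (Prod.mk.inj h).1
    have hbb' : b < b' := by
      by_contra! hb
      have := hseg.2.2 a' b' haa'.le hseg'.1 hb hne.symm
      rw [hseg'.2.1] at this
      exact one_ne_zero this
    have htwo : 1 < LinkPat.Rmat τ₁ a b' := Finset.one_lt_card.2
      ⟨(a, b), by simp [harc, hbb'.le], (a', b'), by simp [harc', haa'.le], hne⟩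
    have := hle₁ a b'
    omega
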